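/- (Restriction to maximal window complexity) Let C be a natural number and let W' ∈ ℕ^{L_2} be a window-size vector with s(W') = Σ_{j=0}^{L_2−1} W'_j < C, and let δ ∈ [0,1]. Then there exists a window-size vector W ∈ ℕ^{L_2} with s(W) = C, W'_j ≤ W_j for all j, and ε^{worst}_{δ,W'} ≤ ε^{worst}_{δ,W}, where ε^{worst}_{δ,W} denotes the worst-case window BP threshold. -/

import Mathlib

/-- Check-node DE map `Y(z)` for the MD-SC ensemble. -/
noncomputable def chkY (L₂ dr γ₁ γ₂ : ℕ) (T : ℝ) (z : ℤ × ZMod L₂ → ℝ)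
    (p : ℤ × ZMod L₂) : ℝ :=
  1 - (1 - ((1 - T) / (γ₁ : ℝ)) * ∑ k ∈ Finset.range γ₁, z (p.1 - (k : ℤ), p.2)
        - (T / ((γ₁ : ℝ) * ((γ₂ : ℝ) - 1))) *
            ∑ k ∈ Finset.range γ₁, ∑ r ∈ Finset.Icc 1 (γ₂ - 1),
              z (p.1 - (k : ℤ), p.2 - (r : ZMod L₂))) ^ (dr - 1)

/-- One-step DE update `F(z)` for the MD-SC ensemble. -/
noncomputable def updF (L₂ dl dr γ₁ γ₂ : ℕ) (T ε : ℝ) (z : ℤ × ZMod L₂ → ℝ)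
    (p : ℤ × ZMod L₂) : ℝ :=
  ε * (((1 - T) / (γ₁ : ℝ)) *
          ∑ k ∈ Finset.range γ₁, chkY L₂ dr γ₁ γ₂ T z (p.1 + (k : ℤ), p.2)
        + (T / ((γ₁ : ℝ) * ((γ₂ : ℝ) - 1))) *
            ∑ k ∈ Finset.range γ₁, ∑ r ∈ Finset.Icc 1 (γ₂ - 1),
              chkY L₂ dr γ₁ γ₂ T z (p.1 + (k : ℤ), p.2 + (r : ZMod L₂))) ^ (dl - 1)
open Classical in
/-- The windowed DE update with window `S`. -/
noncomputable def winUpd (L₂ dl dr γ₁ γ₂ : ℕ) (T ε : ℝ) (S : Set (ℤ × ZMod L₂))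
    (z : ℤ × ZMod L₂ → ℝ) (p : ℤ × ZMod L₂) : ℝ :=
  if p ∈ S then updF L₂ dl dr γ₁ γ₂ T ε z p else z p

/-- Iterates of the windowed DE update starting from `z₀`. -/
noncomputable def winIter (L₂ dl dr γ₁ γ₂ : ℕ) (T ε : ℝ) (S : Set (ℤ × ZMod L₂))
    (z₀ : ℤ × ZMod L₂ → ℝ) : ℕ → ℤ × ZMod L₂ → ℝ
  | 0 => z₀
  | l + 1 => winUpd L₂ dl dr γ₁ γ₂ T ε S (winIter L₂ dl dr γ₁ γ₂ T ε S z₀ l)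
/-- The window configuration `S^W_{(i_t,j_t)}` for window-size vector `W` and target
section `(i_t, j_t)`. -/
def winConfig (L₂ : ℕ) (W : ZMod L₂ → ℕ) (t : ℤ × ZMod L₂) : Set (ℤ × ZMod L₂) :=
  {p | ∃ r : ℕ, r < L₂ ∧ ∃ k : ℕ, k < W (t.2 + (r : ZMod L₂)) ∧
        p = (t.1 + (k : ℤ), t.2 + (r : ZMod L₂))}

/-- The worst-case initial constellation: `δ` for `i < 0` and `1` for `i ≥ 0`. -/
noncomputable def worstInit (L₂ : ℕ) (δ : ℝ) : ℤ × ZMod L₂ → ℝ :=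
  fun p => if p.1 < 0 then δ else 1

/-- The worst-case window constellation `q^[l]` for window-size vector `W`. -/
noncomputable def worstQ (L₂ dl dr γ₁ γ₂ : ℕ) (T ε δ : ℝ) (W : ZMod L₂ → ℕ) :
    ℕ → ℤ × ZMod L₂ → ℝ :=
  winIter L₂ dl dr γ₁ γ₂ T ε (winConfig L₂ W ((0 : ℤ), (0 : ZMod L₂))) (worstInit L₂ δ)
/-- The worst-case window BP threshold `ε^worst_{δ,W}`. -/
noncomputable def epsWorst (L₂ dl dr γ₁ γ₂ : ℕ) (T δ : ℝ) (W : ZMod L₂ → ℕ) : ℝ :=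
  sSup {ε : ℝ | ε ∈ Set.Icc (0 : ℝ) 1 ∧ ∃ a : ℝ, a ≤ δ ∧
    Filter.Tendsto (fun l => worstQ L₂ dl dr γ₁ γ₂ T ε δ W l ((0 : ℤ), (0 : ZMod L₂)))
      Filter.atTop (nhds a)}

/-- The coupling average weighting `γ₁` intra-replica and `γ₁ (γ₂ - 1)` inter-replica values. -/
noncomputable def couplingAvg (γ₁ γ₂ : ℕ) (T : ℝ) (u : ℕ → ℝ) (v : ℕ → ℕ → ℝ) : ℝ :=
  ((1 - T) / (γ₁ : ℝ)) * ∑ k ∈ Finset.range γ₁, u k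
    + (T / ((γ₁ : ℝ) * ((γ₂ : ℝ) - 1))) *
        ∑ k ∈ Finset.range γ₁, ∑ r ∈ Finset.Icc 1 (γ₂ - 1), v k r

section CouplingAvg

variable {γ₁ γ₂ : ℕ} {T : ℝ}

theorem couplingAvg_mono (hγ₂ : 2 ≤ γ₂) (hT : T ∈ Set.Icc (0 : ℝ) 1)
    {u u' : ℕ → ℝ} {v v' : ℕ → ℕ → ℝ} (hu : ∀ k, u k ≤ u' k) (hv : ∀ k r, v k r ≤ v' k r) :
    couplingAvg γ₁ γ₂ T u v ≤ couplingAvg γ₁ γ₂ T u' v' := by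
  have h2 : (0 : ℝ) ≤ (γ₂ : ℝ) - 1 := by
    have : (2 : ℝ) ≤ γ₂ := by exact_mod_cast hγ₂
    linarith
  have hT0 : 0 ≤ T := hT.1
  have hT1 : 0 ≤ 1 - T := sub_nonneg.2 hT.2
  unfold couplingAvg
  gcongr with k _ k _ r _
  · exact hu k
  · exact hv k r

theorem couplingAvg_const (hγ₁ : 1 ≤ γ₁) (hγ₂ : 2 ≤ γ₂) (c : ℝ) :
    couplingAvg γ₁ γ₂ T (fun _ => c) (fun _ _ => c) = c := by
  have h1 : (γ₁ : ℝ) ≠ 0 := by positivity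
  have h2 : (γ₂ : ℝ) - 1 ≠ 0 := by
    have : (2 : ℝ) ≤ γ₂ := by exact_mod_cast hγ₂
    linarith
  have h3 : ((γ₂ - 1 : ℕ) : ℝ) = (γ₂ : ℝ) - 1 := by
    rw [Nat.cast_sub (by omega), Nat.cast_one]
  simp only [couplingAvg, Finset.sum_const, Finset.card_range, Nat.card_Icc, nsmul_eq_mul,
    Nat.add_sub_cancel, h3]
  field_simp
  ring

theorem couplingAvg_mem_Icc (hγ₁ : 1 ≤ γ₁) (hγ₂ : 2 ≤ γ₂) (hT : T ∈ Set.Icc (0 : ℝ) 1)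
    {u : ℕ → ℝ} {v : ℕ → ℕ → ℝ} (hu : ∀ k, u k ∈ Set.Icc (0 : ℝ) 1)
    (hv : ∀ k r, v k r ∈ Set.Icc (0 : ℝ) 1) :
    couplingAvg γ₁ γ₂ T u v ∈ Set.Icc (0 : ℝ) 1 := by
  refine ⟨?_, ?_⟩
  · rw [← couplingAvg_const (T := T) hγ₁ hγ₂ 0]
    exact couplingAvg_mono hγ₂ hT (fun k => (hu k).1) (fun k r => (hv k r).1)
  · conv_rhs => rw [← couplingAvg_const (T := T) hγ₁ hγ₂ 1]
    exact couplingAvg_mono hγ₂ hT (fun k => (hu k).2) (fun k r => (hv k r).2)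

end CouplingAvg

section DensityEvolution

variable {L₂ dl dr γ₁ γ₂ : ℕ} {T ε δ : ℝ} {z z' : ℤ × ZMod L₂ → ℝ}
  {S S' : Set (ℤ × ZMod L₂)}

theorem chkY_eq_couplingAvg (z : ℤ × ZMod L₂ → ℝ) (p : ℤ × ZMod L₂) :
    chkY L₂ dr γ₁ γ₂ T z p =
      1 - (1 - couplingAvg γ₁ γ₂ T (fun k => z (p.1 - (k : ℤ), p.2))
        (fun k r => z (p.1 - (k : ℤ), p.2 - (r : ZMod L₂)))) ^ (dr - 1) := by
  rw [chkY, couplingAvg, sub_sub]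

theorem updF_eq_couplingAvg (z : ℤ × ZMod L₂ → ℝ) (p : ℤ × ZMod L₂) :
    updF L₂ dl dr γ₁ γ₂ T ε z p =
      ε * couplingAvg γ₁ γ₂ T (fun k => chkY L₂ dr γ₁ γ₂ T z (p.1 + (k : ℤ), p.2))
        (fun k r => chkY L₂ dr γ₁ γ₂ T z (p.1 + (k : ℤ), p.2 + (r : ZMod L₂))) ^ (dl - 1) :=
  rfl

theorem chkY_mem_Icc (hγ₁ : 1 ≤ γ₁) (hγ₂ : 2 ≤ γ₂) (hT : T ∈ Set.Icc (0 : ℝ) 1)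
    (hz : ∀ p, z p ∈ Set.Icc (0 : ℝ) 1) (p : ℤ × ZMod L₂) :
    chkY L₂ dr γ₁ γ₂ T z p ∈ Set.Icc (0 : ℝ) 1 := by
  rw [chkY_eq_couplingAvg]
  have h := couplingAvg_mem_Icc hγ₁ hγ₂ hT (fun k => hz (p.1 - (k : ℤ), p.2))
    (fun k r => hz (p.1 - (k : ℤ), p.2 - (r : ZMod L₂)))
  have h0 := pow_nonneg (sub_nonneg.2 h.2) (dr - 1)
  have h1 := pow_le_one₀ (n := dr - 1) (sub_nonneg.2 h.2) (sub_le_self 1 h.1)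
  exact ⟨sub_nonneg.2 h1, sub_le_self 1 h0⟩

theorem chkY_mono (hγ₁ : 1 ≤ γ₁) (hγ₂ : 2 ≤ γ₂) (hT : T ∈ Set.Icc (0 : ℝ) 1)
    (hz' : ∀ p, z' p ∈ Set.Icc (0 : ℝ) 1) (h : z ≤ z') :
    chkY L₂ dr γ₁ γ₂ T z ≤ chkY L₂ dr γ₁ γ₂ T z' := by
  intro p
  rw [chkY_eq_couplingAvg, chkY_eq_couplingAvg]
  have h' := couplingAvg_mem_Icc hγ₁ hγ₂ hT (fun k => hz' (p.1 - (k : ℤ), p.2))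
    (fun k r => hz' (p.1 - (k : ℤ), p.2 - (r : ZMod L₂)))
  exact sub_le_sub_left (pow_le_pow_left₀ (sub_nonneg.2 h'.2)
    (sub_le_sub_left (couplingAvg_mono hγ₂ hT (fun _ => h _) (fun _ _ => h _)) _) _) _

theorem updF_mem_Icc (hγ₁ : 1 ≤ γ₁) (hγ₂ : 2 ≤ γ₂) (hT : T ∈ Set.Icc (0 : ℝ) 1)
    (hε : ε ∈ Set.Icc (0 : ℝ) 1) (hz : ∀ p, z p ∈ Set.Icc (0 : ℝ) 1) (p : ℤ × ZMod L₂) :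
    updF L₂ dl dr γ₁ γ₂ T ε z p ∈ Set.Icc (0 : ℝ) 1 := by
  rw [updF_eq_couplingAvg]
  have h := couplingAvg_mem_Icc hγ₁ hγ₂ hT
    (fun k => chkY_mem_Icc (dr := dr) hγ₁ hγ₂ hT hz (p.1 + (k : ℤ), p.2))
    (fun k r => chkY_mem_Icc (dr := dr) hγ₁ hγ₂ hT hz (p.1 + (k : ℤ), p.2 + (r : ZMod L₂)))
  have h0 := pow_nonneg h.1 (dl - 1)
  exact ⟨mul_nonneg hε.1 h0, mul_le_one₀ hε.2 h0 (pow_le_one₀ h.1 h.2)⟩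

theorem updF_mono (hγ₁ : 1 ≤ γ₁) (hγ₂ : 2 ≤ γ₂) (hT : T ∈ Set.Icc (0 : ℝ) 1)
    (hε : 0 ≤ ε) (hz : ∀ p, z p ∈ Set.Icc (0 : ℝ) 1) (hz' : ∀ p, z' p ∈ Set.Icc (0 : ℝ) 1)
    (h : z ≤ z') :
    updF L₂ dl dr γ₁ γ₂ T ε z ≤ updF L₂ dl dr γ₁ γ₂ T ε z' := by
  intro p
  rw [updF_eq_couplingAvg, updF_eq_couplingAvg]
  have hY := chkY_mono (dr := dr) hγ₁ hγ₂ hT hz' h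
  have h' := couplingAvg_mem_Icc hγ₁ hγ₂ hT
    (fun k => chkY_mem_Icc (dr := dr) hγ₁ hγ₂ hT hz (p.1 + (k : ℤ), p.2))
    (fun k r => chkY_mem_Icc (dr := dr) hγ₁ hγ₂ hT hz (p.1 + (k : ℤ), p.2 + (r : ZMod L₂)))
  exact mul_le_mul_of_nonneg_left (pow_le_pow_left₀ h'.1
    (couplingAvg_mono hγ₂ hT (fun _ => hY _) (fun _ _ => hY _)) _) hε

theorem winUpd_mem_Icc (hγ₁ : 1 ≤ γ₁) (hγ₂ : 2 ≤ γ₂) (hT : T ∈ Set.Icc (0 : ℝ) 1)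
    (hε : ε ∈ Set.Icc (0 : ℝ) 1) (hz : ∀ p, z p ∈ Set.Icc (0 : ℝ) 1) (p : ℤ × ZMod L₂) :
    winUpd L₂ dl dr γ₁ γ₂ T ε S z p ∈ Set.Icc (0 : ℝ) 1 := by
  unfold winUpd
  split_ifs
  · exact updF_mem_Icc hγ₁ hγ₂ hT hε hz p
  · exact hz p

/-- Enlarging the window by sections whose current value is `1` can only lower the update. -/
theorem winUpd_le_winUpd (hγ₁ : 1 ≤ γ₁) (hγ₂ : 2 ≤ γ₂) (hT : T ∈ Set.Icc (0 : ℝ) 1)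
    (hε : ε ∈ Set.Icc (0 : ℝ) 1) (hz : ∀ p, z p ∈ Set.Icc (0 : ℝ) 1)
    (hz' : ∀ p, z' p ∈ Set.Icc (0 : ℝ) 1) (h : z ≤ z') (hS : S' ⊆ S)
    (hone : ∀ p ∈ S \ S', z' p = 1) :
    winUpd L₂ dl dr γ₁ γ₂ T ε S z ≤ winUpd L₂ dl dr γ₁ γ₂ T ε S' z' := by
  intro p
  unfold winUpd
  by_cases hp' : p ∈ S'
  · rw [if_pos hp', if_pos (hS hp')]
    exact updF_mono hγ₁ hγ₂ hT hε.1 hz hz' h p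
  by_cases hp : p ∈ S
  · rw [if_pos hp, if_neg hp', hone p ⟨hp, hp'⟩]
    exact (updF_mem_Icc hγ₁ hγ₂ hT hε hz p).2
  · rw [if_neg hp, if_neg hp']
    exact h p

theorem winIter_of_notMem {z₀ : ℤ × ZMod L₂ → ℝ} {p : ℤ × ZMod L₂} (hp : p ∉ S) (l : ℕ) :
    winIter L₂ dl dr γ₁ γ₂ T ε S z₀ l p = z₀ p := by
  induction l with
  | zero => rfl
  | succ l ih => rw [winIter, winUpd, if_neg hp, ih]

theorem winConfig_mono {W W' : ZMod L₂ → ℕ} (h : W' ≤ W) (t : ℤ × ZMod L₂) :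
    winConfig L₂ W' t ⊆ winConfig L₂ W t := by
  rintro p ⟨r, hr, k, hk, hp⟩
  exact ⟨r, hr, k, hk.trans_le (h _), hp⟩

theorem worstInit_eq_one {W : ZMod L₂ → ℕ} {p : ℤ × ZMod L₂}
    (hp : p ∈ winConfig L₂ W (0, 0)) : worstInit L₂ δ p = 1 := by
  obtain ⟨r, -, k, -, rfl⟩ := hp
  exact if_neg (by simp)

theorem worstInit_mem_Icc (hδ : δ ∈ Set.Icc (0 : ℝ) 1) (p : ℤ × ZMod L₂) :
    worstInit L₂ δ p ∈ Set.Icc (0 : ℝ) 1 := by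
  unfold worstInit
  split_ifs
  · exact hδ
  · exact ⟨zero_le_one, le_rfl⟩

theorem worstQ_mem_Icc (hγ₁ : 1 ≤ γ₁) (hγ₂ : 2 ≤ γ₂) (hT : T ∈ Set.Icc (0 : ℝ) 1)
    (hε : ε ∈ Set.Icc (0 : ℝ) 1) (hδ : δ ∈ Set.Icc (0 : ℝ) 1) (W : ZMod L₂ → ℕ) (l : ℕ)
    (p : ℤ × ZMod L₂) :
    worstQ L₂ dl dr γ₁ γ₂ T ε δ W l p ∈ Set.Icc (0 : ℝ) 1 := by
  induction l generalizing p with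
  | zero => exact worstInit_mem_Icc hδ p
  | succ l ih => exact winUpd_mem_Icc hγ₁ hγ₂ hT hε ih p

theorem worstQ_antitone (hγ₁ : 1 ≤ γ₁) (hγ₂ : 2 ≤ γ₂) (hT : T ∈ Set.Icc (0 : ℝ) 1)
    (hε : ε ∈ Set.Icc (0 : ℝ) 1) (hδ : δ ∈ Set.Icc (0 : ℝ) 1) (W : ZMod L₂ → ℕ) :
    Antitone (worstQ L₂ dl dr γ₁ γ₂ T ε δ W) := by
  have hmem := worstQ_mem_Icc (dl := dl) (dr := dr) hγ₁ hγ₂ hT hε hδ W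
  refine antitone_nat_of_succ_le fun l => ?_
  induction l with
  | zero =>
    intro p
    by_cases hp : p ∈ winConfig L₂ W (0, 0)
    · exact (hmem 1 p).2.trans_eq (worstInit_eq_one hp).symm
    · exact (winIter_of_notMem hp 1).le
  | succ l ih =>
    exact winUpd_le_winUpd hγ₁ hγ₂ hT hε (hmem (l + 1)) (hmem l) ih subset_rfl (by simp)

theorem worstQ_le_worstQ (hγ₁ : 1 ≤ γ₁) (hγ₂ : 2 ≤ γ₂) (hT : T ∈ Set.Icc (0 : ℝ) 1)
    (hε : ε ∈ Set.Icc (0 : ℝ) 1) (hδ : δ ∈ Set.Icc (0 : ℝ) 1) {W W' : ZMod L₂ → ℕ}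
    (hW : W' ≤ W) (l : ℕ) :
    worstQ L₂ dl dr γ₁ γ₂ T ε δ W l ≤ worstQ L₂ dl dr γ₁ γ₂ T ε δ W' l := by
  induction l with
  | zero => exact le_rfl
  | succ l ih =>
    refine winUpd_le_winUpd hγ₁ hγ₂ hT hε (worstQ_mem_Icc hγ₁ hγ₂ hT hε hδ W l)
      (worstQ_mem_Icc hγ₁ hγ₂ hT hε hδ W' l) ih (winConfig_mono hW _) fun p hp => ?_
    exact (winIter_of_notMem hp.2 l).trans (worstInit_eq_one hp.1)

theorem epsWorst_mono (hγ₁ : 1 ≤ γ₁) (hγ₂ : 2 ≤ γ₂) (hT : T ∈ Set.Icc (0 : ℝ) 1)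
    (hδ : δ ∈ Set.Icc (0 : ℝ) 1) {W W' : ZMod L₂ → ℕ} (hW : W' ≤ W) :
    epsWorst L₂ dl dr γ₁ γ₂ T δ W' ≤ epsWorst L₂ dl dr γ₁ γ₂ T δ W := by
  refine Real.sSup_le (fun ε hε => le_csSup ⟨1, fun _ h => h.1.2⟩ ?_)
    (Real.sSup_nonneg fun _ h => h.1.1)
  obtain ⟨hε, a, ha, hlim⟩ := hε
  have hanti : Antitone fun l => worstQ L₂ dl dr γ₁ γ₂ T ε δ W l (0, 0) :=
    fun _ _ h => worstQ_antitone hγ₁ hγ₂ hT hε hδ W h (0, 0)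
  have hbdd : BddBelow (Set.range fun l => worstQ L₂ dl dr γ₁ γ₂ T ε δ W l (0, 0)) :=
    ⟨0, Set.forall_mem_range.2 fun l => (worstQ_mem_Icc hγ₁ hγ₂ hT hε hδ W l _).1⟩
  have hconv := tendsto_atTop_ciInf hanti hbdd
  exact ⟨hε, _, (le_of_tendsto_of_tendsto' hconv hlim fun l =>
    worstQ_le_worstQ hγ₁ hγ₂ hT hε hδ hW l (0, 0)).trans ha, hconv⟩

end DensityEvolution

theorem sum_range_single_zmod {n : ℕ} (hn : 0 < n) (c : ℕ) :
    ∑ j ∈ Finset.range n, (Pi.single 0 c : ZMod n → ℕ) (j : ZMod n) = c := by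
  rw [Finset.sum_eq_single_of_mem 0 (Finset.mem_range.2 hn)]
  · simp
  · intro j hj hj0
    have h0 : (j : ZMod n) ≠ 0 := fun h => hj0 <|
      Nat.eq_zero_of_dvd_of_lt ((ZMod.natCast_eq_zero_iff j n).1 h) (Finset.mem_range.1 hj)
    simp [h0]

/-- restriction to maximal window complexity: if the window-size
vector `W'` has window complexity `s(W') < C`, then there is a window-size vector
`W` with `s(W) = C`, `W' ≤ W` entrywise, and `ε^worst_{δ,W'} ≤ ε^worst_{δ,W}`.
Here `s(W) = Σ_{j=0}^{L₂−1} W_j` is computed by summing over the `L₂` residues. -/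
theorem stmt11 (dl dr L₂ γ₁ γ₂ : ℕ) (T δ : ℝ) (C : ℕ)
    (hdl : 2 ≤ dl) (hdr : 2 ≤ dr) (hL₂ : 2 ≤ L₂)
    (hγ₁ : 1 ≤ γ₁) (hγ₂ : 2 ≤ γ₂) (hγ₂L : γ₂ ≤ L₂)
    (hT : T ∈ Set.Icc (0 : ℝ) 1) (hδ : δ ∈ Set.Icc (0 : ℝ) 1)
    (W' : ZMod L₂ → ℕ)
    (hsW' : ∑ j ∈ Finset.range L₂, W' (j : ZMod L₂) < C) :
    ∃ W : ZMod L₂ → ℕ,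
      (∑ j ∈ Finset.range L₂, W (j : ZMod L₂)) = C ∧
      (∀ j, W' j ≤ W j) ∧
      epsWorst L₂ dl dr γ₁ γ₂ T δ W' ≤ epsWorst L₂ dl dr γ₁ γ₂ T δ W := by
  refine ⟨W' + Pi.single 0 (C - ∑ j ∈ Finset.range L₂, W' (j : ZMod L₂)), ?_,
    fun j => Nat.le_add_right _ _,
    epsWorst_mono hγ₁ hγ₂ hT hδ fun j => Nat.le_add_right _ _⟩
  simp only [Pi.add_apply, Finset.sum_add_distrib, sum_range_single_zmod (by omega : 0 < L₂)]
  omega
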